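/- Let C = C(b₀) for some b₀ ∈ P(m,n), and set w_min = min{|b| : b ∈ 𝔟(C)} and w_max = max{|b| : b ∈ 𝔟(C)}. Then: (1) every b ∈ 𝔟(C) satisfies |b| ≡ w_min (mod 2); (2) for every integer w with w_min ≤ w ≤ w_max and w ≡ w_min (mod 2), there exists b ∈ 𝔟(C) with |b| = w; (3) the weights w_min and w_max are each attained by exactly one element of 𝔟(C). Equivalently, writing the coefficient of C as C(A) = Σ_{b ∈ 𝔟(C)} A^{2|b| − mn} = A^{2 w_min − mn} · Σ_{i=0}^{N} a_i A^{4i} with N = (w_max − w_min)/2, one has a_0 = a_N = 1 and a_i > 0 for all 0 ≤ i ≤ N. -/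

import Mathlib

/-- `Pmn m n = {0, 1, …, n}^m`: integer sequences `b = (b₁, …, b_m)` with `0 ≤ bᵢ ≤ n`,
encoded as lists of length `m`. -/
def Pmn (m n : ℕ) : Set (List ℕ) := {b | b.length = m ∧ ∀ x ∈ b, x ≤ n}

/-- `Pmove n b b'` holds iff `b' = Pᵢ(b)` for some `1 ≤ i ≤ m − 1`: the move `Pᵢ` is
defined on sequences with `bᵢ < b_{i+1} < n` by
`Pᵢ(b) = (b₁, …, b_{i-1}, b_{i+1}+1, bᵢ+1, b_{i+2}, …, b_m)`. -/
def Pmove (n : ℕ) (b b' : List ℕ) : Prop :=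
  ∃ (u v : List ℕ) (x y : ℕ), x < y ∧ y < n ∧
    b = u ++ x :: y :: v ∧ b' = u ++ (y + 1) :: (x + 1) :: v

/-- Boundary points of `B(m,n)` (0-indexed): `ceil j` is the ceiling point `x_{j+1}`,
`floor j` is the floor point `x'_{j+1}`, `left i` is the left-side point `y_{i+1}`, and
`right i` is the right-side point `y'_{i+1}`. -/
inductive Bpt : Type where
  | ceil : ℕ → Bpt
  | floor : ℕ → Bpt
  | left : ℕ → Bpt
  | right : ℕ → Bpt
deriving DecidableEq

/-- The new arc created by the first entry `b₁` of a sequence: `{y₁, x₁}` if `b₁ = 0`,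
`{x_n, y'₁}` if `b₁ = n`, and `{x_{b₁}, x_{b₁+1}}` if `1 ≤ b₁ ≤ n − 1`. -/
def newPair (n b₁ : ℕ) : Sym2 Bpt :=
  if b₁ = 0 then s(Bpt.left 0, Bpt.ceil 0)
  else if b₁ = n then s(Bpt.ceil (n - 1), Bpt.right 0)
  else s(Bpt.ceil (b₁ - 1), Bpt.ceil b₁)

/-- The relabeling map from the boundary points of `B(m-1,n)` into those of `B(m,n)`
determined by the first entry `b₁`: side points `ȳᵢ, ȳ'ᵢ` become `y_{i+1}, y'_{i+1}`;
floor points are unchanged; and the ceiling points `(x̄₁, …, x̄_n)` become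
`(x₂, …, x_n, y'₁)` if `b₁ = 0`, `(y₁, x₁, …, x_{n-1})` if `b₁ = n`, and
`(y₁, x₁, …, x_{b₁-1}, x_{b₁+2}, …, x_n, y'₁)` if `1 ≤ b₁ ≤ n − 1`. -/
def relabel (n b₁ : ℕ) : Bpt → Bpt
  | .floor j => .floor j
  | .left i => .left (i + 1)
  | .right i => .right (i + 1)
  | .ceil j =>
      if b₁ = 0 then (if j = n - 1 then .right 0 else .ceil (j + 1))
      else if j = 0 then .left 0
      else if j ≤ b₁ - 1 then .ceil (j - 1)
      else if j = n - 1 then .right 0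
      else .ceil (j + 1)

/-- The Catalan state (perfect matching of the boundary points of `B(m,n)`)
realized by a sequence `b ∈ P(m,n)`, defined recursively: the empty sequence pairs
`x_j` with `x'_j` for all `j < n`; for `b = b₁ :: rest`, the matching of `rest` on
`B(m-1,n)` is transported along `relabel n b₁` and the new arc `newPair n b₁` is added. -/
def catState (n : ℕ) : List ℕ → Set (Sym2 Bpt)
  | [] => {p | ∃ j < n, p = s(Bpt.ceil j, Bpt.floor j)}
  | b₁ :: rest => insert (newPair n b₁) (Sym2.map (relabel n b₁) '' catState n rest)

/-- The fiber `𝔟(C) = {b ∈ P(m,n) : C(b) = C}` of a Catalan state `C`. -/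
def bSet (m n : ℕ) (C : Set (Sym2 Bpt)) : Set (List ℕ) :=
  {b ∈ Pmn m n | catState n b = C}

/-- Ceiling points of `B(m,n)` have index less than `n`; there is no condition on other points. -/
def Bpt.InRange (n : ℕ) (p : Bpt) : Prop := ∀ j, p = .ceil j → j < n

/-- The reflection of boundary points in the vertical axis. -/
def Bpt.reflect (n : ℕ) : Bpt → Bpt
  | .ceil j => .ceil (n - 1 - j)
  | .floor j => .floor (n - 1 - j)
  | .left i => .right i
  | .right i => .left i

/-- A variant of `relabel n n` that sends the first right-side point to the last ceiling point
instead of shifting it down. -/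
def shiftLeft (n : ℕ) : Bpt → Bpt
  | .right 0 => .ceil (n - 1)
  | p => relabel n n p

theorem inRange_of_mem_catState {n : ℕ} (hn : 1 ≤ n) {b : List ℕ} (hb : ∀ x ∈ b, x ≤ n)
    {p : Sym2 Bpt} (hp : p ∈ catState n b) {a : Bpt} (ha : a ∈ p) : a.InRange n := by
  induction b generalizing p a with
  | nil =>
    obtain ⟨j, hj, rfl⟩ := hp
    rcases Sym2.mem_iff.1 ha with rfl | rfl <;> intro i hi <;> simp_all
  | cons x v ih =>
    have hx : x ≤ n := hb x (by simp)
    rcases hp with rfl | ⟨q, hq, rfl⟩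
    · intro i hi
      unfold newPair at ha
      split_ifs at ha <;> rcases Sym2.mem_iff.1 ha with rfl | rfl <;> simp_all <;> omega
    · obtain ⟨c, hc, rfl⟩ := Sym2.mem_map.1 ha
      have := ih (fun y hy => hb y (by simp [hy])) hq hc
      intro i hi
      cases c with
      | ceil j =>
        have hj := this j rfl
        simp only [relabel] at hi
        split_ifs at hi <;> simp at hi <;> omega
      | _ => simp [relabel] at hi

theorem image_map_congr {n : ℕ} (hn : 1 ≤ n) {b : List ℕ} (hb : ∀ x ∈ b, x ≤ n)
    {f g : Bpt → Bpt} (h : ∀ a : Bpt, a.InRange n → f a = g a) :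
    Sym2.map f '' catState n b = Sym2.map g '' catState n b :=
  Set.image_congr fun _ hp =>
    Sym2.map_congr fun _ ha => h _ (inRange_of_mem_catState hn hb hp ha)

theorem relabel_comm {n x y : ℕ} (hxy : x < y) (hy : y < n) {a : Bpt} (ha : a.InRange n) :
    relabel n x (relabel n y a) = relabel n (y + 1) (relabel n (x + 1) a) := by
  cases a with
  | ceil j =>
    have hj := ha j rfl
    grind [relabel]
  | _ => rfl

theorem map_relabel_newPair {n x y : ℕ} (hxy : x < y) (hy : y < n) :
    Sym2.map (relabel n x) (newPair n y) = newPair n (y + 1) := by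
  simp only [newPair]
  split_ifs <;> simp only [Sym2.map_mk, Sym2.eq_iff] <;> grind [relabel]

theorem map_relabel_newPair_of_lt {n x y : ℕ} (hxy : x < y) (hy : y < n) :
    Sym2.map (relabel n (y + 1)) (newPair n (x + 1)) = newPair n x := by
  simp only [newPair]
  split_ifs <;> simp only [Sym2.map_mk, Sym2.eq_iff] <;> grind [relabel]

theorem catState_move {n x y : ℕ} {v : List ℕ} (hxy : x < y) (hy : y < n)
    (hv : ∀ z ∈ v, z ≤ n) :
    catState n (x :: y :: v) = catState n ((y + 1) :: (x + 1) :: v) := by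
  simp only [catState, Set.image_insert_eq, Set.image_image, Sym2.map_map,
    map_relabel_newPair hxy hy, map_relabel_newPair_of_lt hxy hy]
  rw [Set.insert_comm]
  congr 2
  exact image_map_congr (by omega) hv fun a ha => relabel_comm hxy hy ha

theorem catState_pred_cons {n w : ℕ} {v : List ℕ} (hw : 1 ≤ w) (hwn : w ≤ n)
    (hv : ∀ z ∈ v, z ≤ n) :
    catState n ((w - 1) :: n :: v) =
      insert s(.right 0, .right 1) (Sym2.map (shiftLeft n) '' catState n (w :: v)) := by
  simp only [catState, Set.image_insert_eq, Set.image_image, Sym2.map_map]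
  have h₁ : Sym2.map (relabel n (w - 1)) (newPair n n) = s(.right 0, .right 1) := by
    simp only [newPair]
    split_ifs <;> simp only [Sym2.map_mk, Sym2.eq_iff] <;> grind [relabel]
  have h₂ : Sym2.map (shiftLeft n) (newPair n w) = newPair n (w - 1) := by
    simp only [newPair]
    split_ifs <;> simp only [Sym2.map_mk, Sym2.eq_iff] <;> grind [relabel, shiftLeft]
  have h₃ (a : Bpt) (ha : a.InRange n) :
      (relabel n (w - 1) ∘ relabel n n) a = (shiftLeft n ∘ relabel n w) a := by
    cases a with
    | ceil j =>
      have hj := ha j rfl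
      grind [relabel, shiftLeft]
    | _ => grind [relabel, shiftLeft]
  rw [h₁, h₂, Set.insert_comm, image_map_congr (by omega) hv h₃]

theorem newPair_injective {n : ℕ} : Function.Injective (newPair n) := by
  intro i j h
  simp only [newPair] at h
  split_ifs at h <;> simp only [Sym2.eq_iff] at h <;> grind

theorem newPair_notMem_catState_nil {n i : ℕ} : newPair n i ∉ catState n [] := by
  rintro ⟨j, -, h⟩
  simp only [newPair] at h
  split_ifs at h <;> simp at h

theorem relabel_injOn {n x : ℕ} {a b : Bpt} (ha : a.InRange n)
    (hb : b.InRange n) (h : relabel n x a = relabel n x b) : a = b := by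
  cases a with
  | ceil i =>
    have := ha i rfl
    cases b with
    | ceil j =>
      have := hb j rfl
      grind [relabel]
    | _ => grind [relabel]
  | _ => cases b <;> grind [relabel]

theorem newPair_notMem_image {n x : ℕ} (hn : 1 ≤ n) {v : List ℕ}
    (hv : ∀ z ∈ v, z ≤ n) : newPair n x ∉ Sym2.map (relabel n x) '' catState n v := by
  rintro ⟨p, hp, h⟩
  have hr := fun a => inRange_of_mem_catState hn hv hp (a := a)
  induction p with | _ a b
  have ha := hr a (by simp)
  have hb := hr b (by simp)
  clear hp hr hv
  simp only [newPair, Sym2.map_mk] at h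
  split_ifs at h <;> simp only [Sym2.eq_iff] at h <;>
    cases a <;> cases b <;> grind [relabel, Bpt.InRange]

theorem catState_cons_cancel {n x : ℕ} (hn : 1 ≤ n) {v v' : List ℕ}
    (hv : ∀ z ∈ v, z ≤ n) (hv' : ∀ z ∈ v', z ≤ n)
    (h : catState n (x :: v) = catState n (x :: v')) : catState n v = catState n v' := by
  have key {u u' : List ℕ} (hu : ∀ z ∈ u, z ≤ n) (hu' : ∀ z ∈ u', z ≤ n)
      (h : catState n (x :: u) = catState n (x :: u')) : catState n u ⊆ catState n u' := by
    intro p hp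
    have hm : Sym2.map (relabel n x) p ∈ catState n (x :: u') :=
      h ▸ Set.mem_insert_of_mem _ ⟨p, hp, rfl⟩
    rcases hm with hm | ⟨q, hq, hqp⟩
    · exact (newPair_notMem_image hn hu ⟨p, hp, hm⟩).elim
    · have hr := fun a => inRange_of_mem_catState hn hu hp (a := a)
      have hr' := fun a => inRange_of_mem_catState hn hu' hq (a := a)
      suffices q = p from this ▸ hq
      clear hq hp
      induction p with | _ a b
      induction q with | _ c d
      have inj := @relabel_injOn n x
      simp only [Sym2.map_mk, Sym2.eq_iff, Sym2.mem_iff] at *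
      rcases hqp with ⟨h₁, h₂⟩ | ⟨h₁, h₂⟩
      · exact .inl ⟨inj (hr' c (by simp)) (hr a (by simp)) h₁,
          inj (hr' d (by simp)) (hr b (by simp)) h₂⟩
      · exact .inr ⟨inj (hr' c (by simp)) (hr b (by simp)) h₁,
          inj (hr' d (by simp)) (hr a (by simp)) h₂⟩
  exact (key hv hv' h).antisymm (key hv' hv h.symm)

theorem newPair_mem_tail {n x j : ℕ} {v : List ℕ} (hv : ∀ z ∈ v, z ≤ n) (hxj : x < j)
    (hj : j ≤ n) (h : newPair n j ∈ catState n (x :: v)) :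
    x + 1 < j ∧ newPair n (j - 1) ∈ catState n v := by
  rcases h with h | ⟨p, hp, h⟩
  · exact absurd (newPair_injective h) (by omega)
  · have hr := fun a => inRange_of_mem_catState (by omega) hv hp (a := a)
    suffices x + 1 < j ∧ newPair n (j - 1) = p from ⟨this.1, this.2 ▸ hp⟩
    clear hp
    induction p with | _ a b
    have ha := hr a (by simp)
    have hb := hr b (by simp)
    clear hr hv
    simp only [newPair, Sym2.map_mk] at h ⊢
    split_ifs at h ⊢ <;> simp only [Sym2.eq_iff] at h ⊢ <;>
      cases a <;> cases b <;> grind (splits := 20) [relabel, Bpt.InRange]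

theorem newPair_mem_tail_of_last {n i : ℕ} {v : List ℕ} (hv : ∀ z ∈ v, z ≤ n) (hi : 1 ≤ i)
    (hin : i < n) (h : newPair n i ∈ catState n (n :: v)) :
    i + 1 < n ∧ newPair n (i + 1) ∈ catState n v := by
  rcases h with h | ⟨p, hp, h⟩
  · exact absurd (newPair_injective h) (by omega)
  · have hr := fun a => inRange_of_mem_catState (by omega) hv hp (a := a)
    suffices i + 1 < n ∧ newPair n (i + 1) = p from ⟨this.1, this.2 ▸ hp⟩
    clear hp
    induction p with | _ a b
    have ha := hr a (by simp)
    have hb := hr b (by simp)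
    clear hr hv
    simp only [newPair, Sym2.map_mk] at h ⊢
    split_ifs at h ⊢ <;> simp only [Sym2.eq_iff] at h ⊢ <;>
      cases a <;> cases b <;> grind [relabel, Bpt.InRange]

/-- If the tail realizes a pair strictly to the right of the first entry and not touching the right
side, then the weight can be increased by two. -/
theorem exists_raise {n x i : ℕ} {v : List ℕ} (hv : ∀ z ∈ v, z ≤ n) (hxi : x < i)
    (hin : i < n) (h : newPair n i ∈ catState n v) :
    ∃ (y : ℕ) (u : List ℕ), x ≤ y ∧ y ≤ n ∧ (∀ z ∈ u, z ≤ n) ∧ u.length = v.length ∧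
      catState n (y :: u) = catState n (x :: v) ∧ y + u.sum = x + v.sum + 2 := by
  induction v generalizing x i with
  | nil => exact (newPair_notMem_catState_nil h).elim
  | cons c v ih =>
    have hc : c ≤ n := hv c (by simp)
    have hv' : ∀ z ∈ v, z ≤ n := fun z hz => hv z (by simp [hz])
    rcases hc.eq_or_lt with rfl | hc
    · obtain ⟨hi, h⟩ := newPair_mem_tail_of_last hv' (by omega) hin h
      obtain ⟨y, u, hy, hyn, hu, hlen, hcat, hsum⟩ :=
        ih hv' (Nat.succ_lt_succ hxi) hi h
      refine ⟨y - 1, c :: u, by omega, by omega, by simpa using hu, by simpa using hlen, ?_, ?_⟩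
      · rw [catState_pred_cons (by omega) hyn hu, hcat,
          ← catState_pred_cons (by omega) (by omega) hv', Nat.succ_sub_one]
      · simp only [List.sum_cons]
        omega
    rcases lt_or_ge x c with hxc | hxc
    · refine ⟨c + 1, (x + 1) :: v, by omega, hc, ?_, rfl, (catState_move hxc hc hv').symm, ?_⟩
      · simpa using ⟨by omega, hv'⟩
      · simp only [List.sum_cons]
        omega
    · obtain ⟨hi, h⟩ := newPair_mem_tail hv' (by omega) (by omega) h
      obtain ⟨y, u, -, hyn, hu, hlen, hcat, hsum⟩ :=
        ih (x := c) hv' (i := i - 1) (by omega) (by omega) h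
      refine ⟨x, y :: u, le_rfl, by omega, by simpa using ⟨hyn, hu⟩, by simpa using hlen, ?_, ?_⟩
      · rw [catState, hcat, ← catState]
      · simp only [List.sum_cons]
        omega

/-- No sequence with the same Catalan state as `b` has weight `|b| + 2`. -/
def IsStuck (n : ℕ) (b : List ℕ) : Prop :=
  ∀ c ∈ bSet b.length n (catState n b), c.sum ≠ b.sum + 2

theorem IsStuck.tail {n x : ℕ} {v : List ℕ} (hx : x ≤ n) (h : IsStuck n (x :: v)) :
    IsStuck n v := by
  rintro c ⟨⟨hlen, hc⟩, hcat⟩ hsum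
  refine h (x :: c) ⟨⟨by simpa using hlen, by simpa using ⟨hx, hc⟩⟩, ?_⟩ ?_
  · rw [catState, hcat, ← catState]
  · simp only [List.sum_cons]
    omega

theorem IsStuck.le_head {n x j : ℕ} {v : List ℕ} (hv : ∀ z ∈ v, z ≤ n)
    (hs : IsStuck n (x :: v)) (hj : j ≤ n) (h : newPair n j ∈ catState n (x :: v)) : j ≤ x := by
  by_contra! hxj
  obtain ⟨hx, h⟩ := newPair_mem_tail hv hxj hj h
  obtain ⟨y, u, -, hy, hu, hlen, hcat, hsum⟩ :=
    exists_raise (x := x) hv (i := j - 1) (by omega) (by omega) h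
  refine hs (y :: u) ⟨⟨by simpa using hlen, by simpa using ⟨hy, hu⟩⟩, hcat⟩ ?_
  simp only [List.sum_cons]
  omega

theorem IsStuck.unique {n : ℕ} (hn : 1 ≤ n) {b c : List ℕ} (hb : ∀ z ∈ b, z ≤ n)
    (hc : ∀ z ∈ c, z ≤ n) (hlen : b.length = c.length) (h : catState n b = catState n c)
    (hsb : IsStuck n b) (hsc : IsStuck n c) : b = c := by
  induction b generalizing c with
  | nil => exact (List.length_eq_zero_iff.1 hlen.symm).symm
  | cons x b ih =>
    cases c with
    | nil => simp at hlen
    | cons y c =>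
      simp only [List.mem_cons, forall_eq_or_imp] at hb hc
      obtain rfl : x = y := le_antisymm
        (hsc.le_head hc.2 hb.1 (h ▸ Set.mem_insert _ _))
        (hsb.le_head hb.2 hc.1 (h ▸ Set.mem_insert _ _))
      rw [ih hb.2 hc.2 (by simpa using hlen) (catState_cons_cancel hn hb.2 hc.2 h)
        (hsb.tail hb.1) (hsc.tail hb.1)]

theorem catState_reflect {n : ℕ} (hn : 1 ≤ n) {b : List ℕ} (hb : ∀ z ∈ b, z ≤ n) :
    catState n (b.map (n - ·)) = Sym2.map (Bpt.reflect n) '' catState n b := by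
  induction b with
  | nil =>
    ext p
    constructor
    · rintro ⟨j, hj, rfl⟩
      refine ⟨_, ⟨n - 1 - j, by omega, rfl⟩, ?_⟩
      rw [Sym2.map_mk]
      simp only [Bpt.reflect]
      rw [show n - 1 - (n - 1 - j) = j by omega]
    · rintro ⟨_, ⟨j, hj, rfl⟩, rfl⟩
      exact ⟨n - 1 - j, by omega, rfl⟩
  | cons x v ih =>
    simp only [List.mem_cons, forall_eq_or_imp] at hb
    have hpair : newPair n (n - x) = Sym2.map (Bpt.reflect n) (newPair n x) := by
      have := hb.1
      simp only [newPair]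
      split_ifs <;> simp only [Sym2.map_mk, Sym2.eq_iff] <;> grind [Bpt.reflect]
    simp only [List.map_cons, catState, ih hb.2, Set.image_insert_eq, Set.image_image,
      Sym2.map_map, hpair]
    congr 1
    refine image_map_congr hn hb.2 fun a ha => ?_
    cases a with
    | ceil j =>
      have := ha j rfl
      have := hb.1
      grind [relabel, Bpt.reflect]
    | _ => rfl

theorem map_sub_map_sub {n : ℕ} {b : List ℕ} (hb : ∀ z ∈ b, z ≤ n) :
    (b.map (n - ·)).map (n - ·) = b := by
  rw [List.map_map]
  exact (List.map_congr_left fun z hz => Nat.sub_sub_self (hb z hz)).trans b.map_id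

theorem sum_map_sub {n : ℕ} {b : List ℕ} (hb : ∀ z ∈ b, z ≤ n) :
    (b.map (n - ·)).sum + b.sum = b.length * n := by
  induction b with
  | nil => simp
  | cons x v ih =>
    simp only [List.mem_cons, forall_eq_or_imp] at hb
    have := ih hb.2
    have := hb.1
    simp only [List.map_cons, List.sum_cons, List.length_cons, Nat.succ_mul]
    omega

theorem isStuck_of_forall_le {m n W : ℕ} {b₀ b : List ℕ} (hb : b ∈ bSet m n (catState n b₀))
    (hW : ∀ c ∈ bSet m n (catState n b₀), c.sum ≤ W) (hbW : b.sum = W) : IsStuck n b := by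
  obtain ⟨⟨hlen, hbn⟩, hcat⟩ := hb
  intro c hc hsum
  rw [hlen, hcat] at hc
  have := hW c hc
  omega

theorem isStuck_map_sub_of_forall_le {m n W : ℕ} (hn : 1 ≤ n) {b₀ b : List ℕ}
    (hb : b ∈ bSet m n (catState n b₀))
    (hW : ∀ c ∈ bSet m n (catState n b₀), W ≤ c.sum) (hbW : b.sum = W) :
    IsStuck n (b.map (n - ·)) := by
  obtain ⟨⟨hlen, hbn⟩, hcat⟩ := hb
  rintro c ⟨⟨hclen, hcn⟩, hccat⟩ hsum
  rw [List.length_map] at hclen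
  have hle : ∀ u : List ℕ, ∀ z ∈ u.map (n - ·), z ≤ n := by
    intro u z hz
    obtain ⟨y, -, rfl⟩ := List.mem_map.1 hz
    exact Nat.sub_le n y
  have := hW (c.map (n - ·)) ⟨⟨by rw [List.length_map, hclen, hlen], hle c⟩, by
    rw [catState_reflect hn hcn, hccat, ← catState_reflect hn (hle b), map_sub_map_sub hbn, hcat]⟩
  have h₁ := sum_map_sub hbn
  have h₂ := sum_map_sub hcn
  rw [hclen] at h₂
  omega

/-- In a graded finite set where the only element without an upper neighbour (two levels higher) is
`t`, every element reaches `t` through all intermediate levels of the right parity. -/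
theorem exists_level_of_unique_stuck {α : Type*} {F : Set α} {f : α → ℕ} {t : α}
    (hmax : ∀ a ∈ F, f a ≤ f t) (hstep : ∀ a ∈ F, a ≠ t → ∃ c ∈ F, f c = f a + 2)
    {a : α} (ha : a ∈ F) :
    f a % 2 = f t % 2 ∧ ∀ w, f a ≤ w → w ≤ f t → w % 2 = f a % 2 → ∃ c ∈ F, f c = w := by
  induction h : f t - f a using Nat.strong_induction_on generalizing a with
  | _ k ih =>
    by_cases hat : a = t
    · subst hat
      exact ⟨rfl, fun w h₁ h₂ _ => ⟨a, ha, by omega⟩⟩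
    · obtain ⟨c, hc, hfc⟩ := hstep a ha hat
      have := hmax c hc
      obtain ⟨hpar, hlev⟩ := ih (f t - f c) (by omega) hc rfl
      refine ⟨by omega, fun w h₁ h₂ h₃ => ?_⟩
      rcases h₁.eq_or_lt with rfl | h₁
      · exact ⟨a, ha, rfl⟩
      · exact hlev w (by omega) h₂ (by omega)

/-- Let `C = C(b₀)` for some `b₀ ∈ P(m,n)`, and let `w_min` and `w_max` be the minimal
and maximal weights of elements of the fiber `𝔟(C)`.  Then:
(1) every `b ∈ 𝔟(C)` has `|b| ≡ w_min (mod 2)`;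
(2) every `w` with `w_min ≤ w ≤ w_max` and `w ≡ w_min (mod 2)` is attained as `|b|` for
some `b ∈ 𝔟(C)`;
(3) the weights `w_min` and `w_max` are each attained by exactly one element of `𝔟(C)`.
Equivalently, writing `C(A) = Σ_{b ∈ 𝔟(C)} A^{2|b| − mn} = A^{2 w_min − mn} Σᵢ aᵢ A^{4i}`,
one has `a₀ = a_N = 1` and `aᵢ > 0` for `0 ≤ i ≤ N = (w_max − w_min)/2`. -/
theorem weights_of_fiber (m n : ℕ) (hm : 1 ≤ m) (hn : 1 ≤ n)
    (b₀ : List ℕ) (hb₀ : b₀ ∈ Pmn m n) (wmin wmax : ℕ)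
    (hwmin : (∃ b ∈ bSet m n (catState n b₀), b.sum = wmin) ∧
      ∀ b ∈ bSet m n (catState n b₀), wmin ≤ b.sum)
    (hwmax : (∃ b ∈ bSet m n (catState n b₀), b.sum = wmax) ∧
      ∀ b ∈ bSet m n (catState n b₀), b.sum ≤ wmax) :
    (∀ b ∈ bSet m n (catState n b₀), b.sum % 2 = wmin % 2) ∧
    (∀ w, wmin ≤ w → w ≤ wmax → w % 2 = wmin % 2 →
      ∃ b ∈ bSet m n (catState n b₀), b.sum = w) ∧
    (∀ b ∈ bSet m n (catState n b₀), ∀ b' ∈ bSet m n (catState n b₀),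
      b.sum = wmin → b'.sum = wmin → b = b') ∧
    (∀ b ∈ bSet m n (catState n b₀), ∀ b' ∈ bSet m n (catState n b₀),
      b.sum = wmax → b'.sum = wmax → b = b') := by
  obtain ⟨⟨s, hs, hsw⟩, hmin⟩ := hwmin
  obtain ⟨⟨t, ht, rfl⟩, hmax⟩ := hwmax
  have huniq {b c : List ℕ} (hb : b ∈ bSet m n (catState n b₀))
      (hc : c ∈ bSet m n (catState n b₀)) (hsb : IsStuck n b) (hsc : IsStuck n c) : b = c :=
    hsb.unique hn hb.1.2 hc.1.2 (hb.1.1.trans hc.1.1.symm) (hb.2.trans hc.2.symm) hsc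
  have hstep : ∀ b ∈ bSet m n (catState n b₀), b ≠ t →
      ∃ c ∈ bSet m n (catState n b₀), c.sum = b.sum + 2 := by
    intro b hb hbt
    by_contra! hno
    refine hbt (huniq hb ht (fun c hc => hno c ?_) (isStuck_of_forall_le ht hmax rfl))
    rwa [hb.1.1, hb.2] at hc
  have hlev {b : List ℕ} (hb : b ∈ bSet m n (catState n b₀)) :=
    exists_level_of_unique_stuck (f := List.sum) hmax hstep hb
  subst hsw
  refine ⟨fun b hb => (hlev hb).1.trans (hlev hs).1.symm, (hlev hs).2, ?_, ?_⟩
  · intro b hb c hc hbw hcw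
    have hle : ∀ u : List ℕ, ∀ z ∈ u.map (n - ·), z ≤ n := by
      intro u z hz
      obtain ⟨y, -, rfl⟩ := List.mem_map.1 hz
      exact Nat.sub_le n y
    have hbc := (isStuck_map_sub_of_forall_le hn hb hmin hbw).unique hn (hle b) (hle c)
      (by simp [hb.1.1, hc.1.1])
      (by rw [catState_reflect hn hb.1.2, catState_reflect hn hc.1.2, hb.2, hc.2])
      (isStuck_map_sub_of_forall_le hn hc hmin hcw)
    rw [← map_sub_map_sub hb.1.2, hbc, map_sub_map_sub hc.1.2]
  · intro b hb c hc hbw hcw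
    exact huniq hb hc (isStuck_of_forall_le hb hmax hbw) (isStuck_of_forall_le hc hmax hcw)
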